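/- Let B = (A, R) be a blueprint and I an ideal of B that contains all absorbing elements of B. Then the relation ∼_I is a congruence on B whose absorbing ideal equals I, and ∼_I is the smallest such congruence: every congruence on B whose absorbing ideal is I contains ∼_I. -/

import Mathlib

/-! Congruences on a blueprint `B = (A, R)`, where `R` is a pre-addition, i.e. a semiring
congruence (`RingCon`) on the monoid semiring `ℕ[A] = MonoidAlgebra ℕ A`. -/

/-- `x` and `y` are termwise related sums: `x = Σ aᵢ`, `y = Σ bᵢ` with `r aᵢ bᵢ` for all `i`. -/
def Blueprint.Termwise {A : Type*} [CommMonoid A] (r : A → A → Prop)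
    (x y : MonoidAlgebra ℕ A) : Prop :=
  ∃ l : List (A × A), (∀ p ∈ l, r p.1 p.2) ∧
    x = (l.map fun p => MonoidAlgebra.of ℕ A p.1).sum ∧
    y = (l.map fun p => MonoidAlgebra.of ℕ A p.2).sum

/-- The linear extension `∼_ℕ` of a relation `∼` on `A` to `ℕ[A]`: the smallest equivalence
relation such that `Σ aᵢ ∼_ℕ Σ bᵢ` whenever `aᵢ ∼ bᵢ` termwise. -/
def Blueprint.LinExt {A : Type*} [CommMonoid A] (r : A → A → Prop) :
    MonoidAlgebra ℕ A → MonoidAlgebra ℕ A → Prop :=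
  Relation.EqvGen (Blueprint.Termwise r)

/-- `∼_R`: the smallest equivalence relation on `ℕ[A]` containing both `R` and `∼_ℕ`. -/
def Blueprint.SimR {A : Type*} [CommMonoid A] (R : RingCon (MonoidAlgebra ℕ A))
    (r : A → A → Prop) : MonoidAlgebra ℕ A → MonoidAlgebra ℕ A → Prop :=
  Relation.EqvGen (fun x y => R x y ∨ Blueprint.LinExt r x y)

/-- A congruence on the blueprint `(A, R)`: an equivalence relation `∼` on `A` such that
(C1) `∼_ℕ` is a pre-addition (additive and multiplicative) and (C2) the restriction of
`∼_R` to `A` equals `∼`. -/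
structure Blueprint.IsCongruence {A : Type*} [CommMonoid A]
    (R : RingCon (MonoidAlgebra ℕ A)) (r : A → A → Prop) : Prop where
  equiv : Equivalence r
  lin_add : ∀ x x' y y' : MonoidAlgebra ℕ A, Blueprint.LinExt r x x' →
    Blueprint.LinExt r y y' → Blueprint.LinExt r (x + y) (x' + y')
  lin_mul : ∀ x x' y y' : MonoidAlgebra ℕ A, Blueprint.LinExt r x x' →
    Blueprint.LinExt r y y' → Blueprint.LinExt r (x * y) (x' * y')
  restrict : ∀ a b : A,
    Blueprint.SimR R r (MonoidAlgebra.of ℕ A a) (MonoidAlgebra.of ℕ A b) ↔ r a b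

/-- A finite chain `x ≡ Σc₁ ∼_ℕ Σd₁ ≡ Σc₂ ∼_ℕ ⋯ ∼_ℕ Σdₙ ≡ y` alternating between the
pre-addition `R` and the linear extension `∼_ℕ` of `∼`. -/
def Blueprint.ChainRel {A : Type*} [CommMonoid A] (R : RingCon (MonoidAlgebra ℕ A))
    (r : A → A → Prop) (x y : MonoidAlgebra ℕ A) : Prop :=
  ∃ z : MonoidAlgebra ℕ A, R x z ∧
    Relation.ReflTransGen (fun u v => ∃ w, Blueprint.LinExt r u w ∧ R w v) z y

/-- The equivalence relation `∼^I` on `A` associated to a subset `I ⊆ A`: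
`a ∼^I b` iff `a = b` or `a, b ∈ I`. -/
def Blueprint.relOfSet {A : Type*} (I : Set A) : A → A → Prop :=
  fun a b => a = b ∨ (a ∈ I ∧ b ∈ I)

/-- The relation `∼_I` on `A`: the restriction to `A` of the smallest equivalence relation
on `ℕ[A]` containing `R` and the linear extension of `∼^I`. -/
def Blueprint.SimI {A : Type*} [CommMonoid A] (R : RingCon (MonoidAlgebra ℕ A))
    (I : Set A) : A → A → Prop :=
  fun a b => Blueprint.SimR R (Blueprint.relOfSet I)
    (MonoidAlgebra.of ℕ A a) (MonoidAlgebra.of ℕ A b)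

/-- An ideal of the blueprint `B = (A, R)`. -/
structure Blueprint.IsIdeal {A : Type*} [CommMonoid A]
    (R : RingCon (MonoidAlgebra ℕ A)) (I : Set A) : Prop where
  mul_mem : ∀ a ∈ I, ∀ b : A, a * b ∈ I
  zero_mem : ∀ e : A, R (MonoidAlgebra.of ℕ A e) 0 → e ∈ I
  closed : ∀ a b : A, Blueprint.SimI R I a b → b ∈ I → a ∈ I

namespace Blueprint

variable {A : Type*} [CommMonoid A]

section EqvGen

variable {M : Type*} {s : M → M → Prop}

/-- The equivalence relation generated by a translation-invariant relation is additive. -/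
theorem eqvGen_add [AddCommMonoid M] (hs : ∀ x y z, s x y → s (x + z) (y + z)) {x x' y y' : M}
    (hx : Relation.EqvGen s x x') (hy : Relation.EqvGen s y y') :
    Relation.EqvGen s (x + y) (x' + y') := by
  have key : ∀ {u v : M} (z : M), Relation.EqvGen s u v →
      Relation.EqvGen s (u + z) (v + z) := by
    intro u v z h
    induction h with
    | rel _ _ h => exact .rel _ _ (hs _ _ z h)
    | refl _ => exact .refl _
    | symm _ _ _ ih => exact .symm _ _ ih
    | trans _ _ _ _ _ ih₁ ih₂ => exact .trans _ _ _ ih₁ ih₂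
  refine .trans _ _ _ (key y hx) ?_
  rw [add_comm x' y, add_comm x' y']
  exact key x' hy

/-- The equivalence relation generated by a scaling-invariant relation is multiplicative. -/
theorem eqvGen_mul [CommMonoid M] (hs : ∀ x y z, s x y → s (x * z) (y * z)) {x x' y y' : M}
    (hx : Relation.EqvGen s x x') (hy : Relation.EqvGen s y y') :
    Relation.EqvGen s (x * y) (x' * y') :=
  eqvGen_add (M := Additive M) hs hx hy

end EqvGen

/-- To prove a property of all elements of `ℕ[A]`, it suffices to treat sums of elements of `A`. -/
theorem induction_sum {P : MonoidAlgebra ℕ A → Prop} (h0 : P 0)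
    (hadd : ∀ x y, P x → P y → P (x + y)) (hof : ∀ a, P (MonoidAlgebra.of ℕ A a))
    (x : MonoidAlgebra ℕ A) : P x := by
  induction x using MonoidAlgebra.induction_on with
  | of a => exact hof a
  | add x y hx hy => exact hadd x y hx hy
  | smul n x hx =>
    induction n with
    | zero => simpa using h0
    | succ n ih =>
      rw [succ_nsmul]
      exact hadd _ _ ih hx

variable {r r' : A → A → Prop} {x x' y y' : MonoidAlgebra ℕ A}

theorem Termwise.zero : Termwise r 0 0 := ⟨[], by simp⟩

theorem Termwise.of {a b : A} (h : r a b) :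
    Termwise r (MonoidAlgebra.of ℕ A a) (MonoidAlgebra.of ℕ A b) :=
  ⟨[(a, b)], by simpa using h⟩

theorem Termwise.add (hx : Termwise r x x') (hy : Termwise r y y') :
    Termwise r (x + y) (x' + y') := by
  obtain ⟨l, hl, rfl, rfl⟩ := hx
  obtain ⟨m, hm, rfl, rfl⟩ := hy
  refine ⟨l ++ m, fun p hp => ?_, by simp, by simp⟩
  exact (List.mem_append.1 hp).elim (hl p) (hm p)

theorem Termwise.refl (hr : ∀ a, r a a) (x : MonoidAlgebra ℕ A) : Termwise r x x :=
  induction_sum (P := fun x => Termwise r x x) .zero (fun _ _ => .add) (fun a => .of (hr a)) x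

theorem Termwise.mono (h : ∀ a b, r a b → r' a b) (hx : Termwise r x y) : Termwise r' x y := by
  obtain ⟨l, hl, hx, hy⟩ := hx
  exact ⟨l, fun p hp => h _ _ (hl p hp), hx, hy⟩

theorem Termwise.mul_right (hr : ∀ a b c, r a b → r (a * c) (b * c)) (hx : Termwise r x y)
    (z : MonoidAlgebra ℕ A) : Termwise r (x * z) (y * z) := by
  induction z using induction_sum with
  | h0 => simpa using Termwise.zero
  | hadd z w hz hw =>
    rw [mul_add, mul_add]
    exact hz.add hw
  | hof c =>
    obtain ⟨l, hl, rfl, rfl⟩ := hx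
    refine ⟨l.map fun p => (p.1 * c, p.2 * c), ?_, ?_, ?_⟩
    · intro p hp
      obtain ⟨q, hq, rfl⟩ := List.mem_map.1 hp
      exact hr _ _ _ (hl q hq)
    all_goals
      simp only [List.map_map, Function.comp_def, map_mul]
      exact (List.sum_map_mul_right ..).symm

theorem LinExt.add (hr : ∀ a, r a a) (hx : LinExt r x x') (hy : LinExt r y y') :
    LinExt r (x + y) (x' + y') :=
  eqvGen_add (fun _ _ z h => h.add (.refl hr z)) hx hy

theorem LinExt.mul (hr : ∀ a b c, r a b → r (a * c) (b * c)) (hx : LinExt r x x')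
    (hy : LinExt r y y') : LinExt r (x * y) (x' * y') :=
  eqvGen_mul (fun _ _ z h => h.mul_right hr z) hx hy

theorem LinExt.of {a b : A} (h : r a b) :
    LinExt r (MonoidAlgebra.of ℕ A a) (MonoidAlgebra.of ℕ A b) :=
  .rel _ _ (.of h)

theorem LinExt.mono (h : ∀ a b, r a b → r' a b) (hx : LinExt r x y) : LinExt r' x y :=
  Relation.EqvGen.mono (fun _ _ => Termwise.mono h) _ _ hx

variable {R : RingCon (MonoidAlgebra ℕ A)}

theorem SimR.of {a b : A} (h : r a b) :
    SimR R r (MonoidAlgebra.of ℕ A a) (MonoidAlgebra.of ℕ A b) :=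
  .rel _ _ (.inr (.of h))

theorem SimR.mono (h : ∀ a b, r a b → r' a b) (hx : SimR R r x y) : SimR R r' x y :=
  Relation.EqvGen.mono (fun _ _ => Or.imp_right (LinExt.mono h)) _ _ hx

theorem SimR.add (hr : ∀ a, r a a) (hx : SimR R r x x') (hy : SimR R r y y') :
    SimR R r (x + y) (x' + y') :=
  eqvGen_add (fun _ _ z => Or.imp (fun h => R.add h (R.refl z))
    fun h => h.add hr (.refl z)) hx hy

theorem SimR.mul (hr : ∀ a b c, r a b → r (a * c) (b * c)) (hx : SimR R r x x')
    (hy : SimR R r y y') : SimR R r (x * y) (x' * y') :=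
  eqvGen_mul (fun _ _ z => Or.imp (fun h => R.mul h (R.refl z))
    fun h => h.mul hr (.refl z)) hx hy

/-- Passing from `r` to the restriction of `∼_R` to `A` does not enlarge `∼_R`. -/
theorem SimR.of_restrict (hr : ∀ a, r a a)
    (h : SimR R (fun a b => SimR R r (MonoidAlgebra.of ℕ A a) (MonoidAlgebra.of ℕ A b)) x y) :
    SimR R r x y := by
  refine Relation.EqvGen.rec (fun u v huv => ?_) .refl (fun _ _ _ => .symm _ _)
    (fun _ _ _ _ _ => .trans _ _ _) h
  rcases huv with huv | huv
  · exact .rel _ _ (.inl huv)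
  refine Relation.EqvGen.rec (fun u v huv => ?_) .refl (fun _ _ _ => .symm _ _)
    (fun _ _ _ _ _ => .trans _ _ _) huv
  obtain ⟨l, hl, rfl, rfl⟩ := huv
  induction l with
  | nil => exact .refl _
  | cons p l ih =>
    simp only [List.map_cons, List.sum_cons]
    exact SimR.add hr (hl p (by simp)) (ih fun q hq => hl q (by simp [hq]))

/-- The restriction to `A` of `∼_R` is a congruence whenever `r` is reflexive and
multiplicative. -/
theorem isCongruence_restrict_simR (hr : ∀ a, r a a)
    (hmul : ∀ a b c, r a b → r (a * c) (b * c)) :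
    IsCongruence R
      fun a b => SimR R r (MonoidAlgebra.of ℕ A a) (MonoidAlgebra.of ℕ A b) where
  equiv := ⟨fun _ => .refl _, .symm _ _, .trans _ _ _⟩
  lin_add _ _ _ _ := LinExt.add fun _ => .refl _
  lin_mul _ _ _ _ := LinExt.mul fun a b c h => by
    rw [map_mul, map_mul]
    exact SimR.mul hmul h (.refl _)
  restrict _ _ := ⟨SimR.of_restrict hr, fun h => SimR.of h⟩

theorem simI_of_mem {I : Set A} {a b : A} (ha : a ∈ I) (hb : b ∈ I) : SimI R I a b :=
  SimR.of (.inr ⟨ha, hb⟩)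

theorem linExt_eq_of_empty (h : LinExt (relOfSet (∅ : Set A)) x y) : x = y := by
  refine Relation.EqvGen.rec (fun u v huv => ?_) (fun _ => rfl) (fun _ _ _ => Eq.symm)
    (fun _ _ _ _ _ => Eq.trans) h
  obtain ⟨l, hl, rfl, rfl⟩ := huv
  refine congrArg List.sum (List.map_congr_left fun p hp => ?_)
  rw [(hl p hp).resolve_right fun h => h.1]

theorem rel_of_simI_empty {a b : A} (h : SimI R ∅ a b) :
    R (MonoidAlgebra.of ℕ A a) (MonoidAlgebra.of ℕ A b) := by
  refine Relation.EqvGen.rec (motive := fun x y _ => R x y) (fun u v huv => ?_) R.refl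
    (fun _ _ _ => R.symm) (fun _ _ _ _ _ => R.trans) h
  rcases huv with huv | huv
  · exact huv
  · exact linExt_eq_of_empty huv ▸ R.refl u

end Blueprint

/-- Let `I` be an ideal of the blueprint `B = (A, R)` containing all absorbing
elements of `B`. Then `∼_I` is a congruence on `B` whose absorbing ideal equals `I`, and it
is the smallest such congruence: every congruence with absorbing ideal `I` contains `∼_I`. -/
theorem blueprint_simI_smallest_congruence {A : Type*} [CommMonoid A]
    (R : RingCon (MonoidAlgebra ℕ A)) (I : Set A)
    (hI : Blueprint.IsIdeal R I)
    (habs : ∀ e : A, (∀ b : A, R (MonoidAlgebra.of ℕ A (e * b)) (MonoidAlgebra.of ℕ A e)) →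
      e ∈ I) :
    Blueprint.IsCongruence R (Blueprint.SimI R I) ∧
    {e : A | ∀ b : A, Blueprint.SimI R I (e * b) e} = I ∧
    (∀ r : A → A → Prop, Blueprint.IsCongruence R r →
      {e : A | ∀ b : A, r (e * b) e} = I →
      ∀ a b : A, Blueprint.SimI R I a b → r a b) := by
  open Blueprint in
  refine ⟨isCongruence_restrict_simR (fun _ => .inl rfl) fun a b c h => ?_,
    Set.ext fun e => ⟨fun he => ?_, fun he b => simI_of_mem (hI.mul_mem e he b) he⟩,
    fun r hr hrI a b hab => (hr.restrict a b).1 (hab.mono fun c d h => ?_)⟩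
  · exact h.imp (congrArg (· * c)) fun h => ⟨hI.mul_mem a h.1 c, hI.mul_mem b h.2 c⟩
  · rcases I.eq_empty_or_nonempty with rfl | ⟨b, hb⟩
    · exact habs e fun b => rel_of_simI_empty (he b)
    · exact hI.closed e (e * b) (.symm _ _ (he b)) (mul_comm b e ▸ hI.mul_mem b hb e)
  · rcases h with rfl | ⟨hc, hd⟩
    · exact hr.equiv.refl c
    · rw [← hrI] at hc hd
      exact hr.equiv.trans (hr.equiv.symm (hc d)) (mul_comm d c ▸ hd c)
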